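/- For all positive integers n, k, m, l, the number of fillings of the staircase polyomino P_n with nonnegative integer entries having exactly l nonzero entries, entry sum equal to m, and longest north-east chain of length exactly k, equals the number of fillings of P_n with nonnegative integer entries having exactly l nonzero entries, entry sum equal to m, and longest south-east chain of length exactly k. -/

import Mathlib

open scoped Classical
noncomputable section

/-! ### Set partitions of type A -/

/-- A set partition of `[n] = {1,…,n}`: pairwise disjoint nonempty blocks covering `[n]`. -/
structure SetPartitionA (n : ℕ) where
  blocks : Finset (Finset ℕ)
  nonempty : ∀ B ∈ blocks, B.Nonempty
  disj : ∀ B ∈ blocks, ∀ B' ∈ blocks, B ≠ B' → Disjoint B B'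
  cover : ∀ i : ℕ, (∃ B ∈ blocks, i ∈ B) ↔ i ∈ Finset.Icc 1 n

/-- Two arcs `(i,j)`, `(i',j')` cross if `i<i'<j<j'` (in either order of the two arcs). -/
def ACross (a b : ℕ × ℕ) : Prop :=
  (a.1 < b.1 ∧ b.1 < a.2 ∧ a.2 < b.2) ∨ (b.1 < a.1 ∧ a.1 < b.2 ∧ b.2 < a.2)

/-- Two arcs `(i,j)`, `(i',j')` nest if `i<i'<j'<j` (in either order of the two arcs). -/
def ANest (a b : ℕ × ℕ) : Prop :=
  (a.1 < b.1 ∧ b.1 < b.2 ∧ b.2 < a.2) ∨ (b.1 < a.1 ∧ a.1 < a.2 ∧ a.2 < b.2)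

namespace SetPartitionA

variable {n : ℕ}

/-- Openers: elements of `[n]` that are not the maximum of their block. -/
def openers (P : SetPartitionA n) : Finset ℕ :=
  (Finset.Icc 1 n).filter fun i => ∃ B ∈ P.blocks, i ∈ B ∧ ∃ j ∈ B, i < j

/-- Closers: elements of `[n]` that are not the minimum of their block. -/
def closers (P : SetPartitionA n) : Finset ℕ :=
  (Finset.Icc 1 n).filter fun i => ∃ B ∈ P.blocks, i ∈ B ∧ ∃ j ∈ B, j < i

/-- `(i,j)` is an arc: `i < j` are in the same block with no block element in between. -/
def IsArc (P : SetPartitionA n) (i j : ℕ) : Prop :=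
  i < j ∧ ∃ B ∈ P.blocks, i ∈ B ∧ j ∈ B ∧ ∀ k ∈ B, ¬(i < k ∧ k < j)

/-- The finite set of arcs of `P`. -/
def arcs (P : SetPartitionA n) : Finset (ℕ × ℕ) :=
  ((Finset.Icc 1 n) ×ˢ (Finset.Icc 1 n)).filter fun p => P.IsArc p.1 p.2

/-- The number of crossings: pairs of arcs `(i,j)`, `(i',j')` with `i<i'<j<j'`. -/
def crossings (P : SetPartitionA n) : ℕ :=
  ((P.arcs ×ˢ P.arcs).filter fun q =>
    q.1.1 < q.2.1 ∧ q.2.1 < q.1.2 ∧ q.1.2 < q.2.2).card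

/-- The number of nestings: pairs of arcs `(i,j)`, `(i',j')` with `i<i'<j'<j`. -/
def nestings (P : SetPartitionA n) : ℕ :=
  ((P.arcs ×ˢ P.arcs).filter fun q =>
    q.1.1 < q.2.1 ∧ q.2.1 < q.2.2 ∧ q.2.2 < q.1.2).card

/-- The cardinality of a maximal crossing: largest set of mutually crossing arcs. -/
def maxCrossing (P : SetPartitionA n) : ℕ :=
  (P.arcs.powerset.filter fun S => ∀ a ∈ S, ∀ b ∈ S, a ≠ b → ACross a b).sup Finset.card

/-- The cardinality of a maximal nesting: largest set of mutually nesting arcs. -/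
def maxNesting (P : SetPartitionA n) : ℕ :=
  (P.arcs.powerset.filter fun S => ∀ a ∈ S, ∀ b ∈ S, a ≠ b → ANest a b).sup Finset.card

end SetPartitionA

/-! ### Set partitions of classical types B/C/D on `[±n]` -/

/-- Position of `i ∈ [±n]` in the type `C` nesting order `1<⋯<n<-n<⋯<-1`. -/
def nestOrd (n : ℕ) (i : ℤ) : ℤ := if 0 < i then i else 2 * n + 1 + i

/-- Position of `i ∈ [±n]` in the crossing order `1<⋯<n<-1<⋯<-n`. -/
def crossOrd (n : ℕ) (i : ℤ) : ℤ := if 0 < i then i else (n : ℤ) - i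

/-- Position of `i ∈ [±n] ∪ {0}` in the type `B` nesting order `1<⋯<n<0<-n<⋯<-1`. -/
def nestOrdB (n : ℕ) (i : ℤ) : ℤ :=
  if 0 < i then i else if i = 0 then (n : ℤ) + 1 else 2 * n + 2 + i

/-- The negative `-B` of a block. -/
def negSet (B : Finset ℤ) : Finset ℤ := B.image fun x => -x

/-- A set partition of type `B_n`/`C_n`: a set partition of `[±n]` with `B ∈ 𝓑 ↔ -B ∈ 𝓑`
and at most one block `B₀` with `B₀ = -B₀`. -/
structure SetPartitionC (n : ℕ) where
  blocks : Finset (Finset ℤ)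
  nonempty : ∀ B ∈ blocks, B.Nonempty
  disj : ∀ B ∈ blocks, ∀ B' ∈ blocks, B ≠ B' → Disjoint B B'
  cover : ∀ i : ℤ, (∃ B ∈ blocks, i ∈ B) ↔ (i ≠ 0 ∧ |i| ≤ (n : ℤ))
  symm : ∀ B ∈ blocks, negSet B ∈ blocks
  zeroBlock : ∀ B ∈ blocks, ∀ B' ∈ blocks, negSet B = B → negSet B' = B' → B = B'

/-- Endpoints of an arc, ordered by the crossing order. -/
def cpr (n : ℕ) (p : ℤ × ℤ) : ℤ × ℤ :=
  (min (crossOrd n p.1) (crossOrd n p.2), max (crossOrd n p.1) (crossOrd n p.2))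

/-- `p` crosses `q` with `p` coming first in the crossing order. -/
def CrossRel (n : ℕ) (p q : ℤ × ℤ) : Prop :=
  (cpr n p).1 < (cpr n q).1 ∧ (cpr n q).1 < (cpr n p).2 ∧ (cpr n p).2 < (cpr n q).2

/-- The two arcs `p`, `q` cross in the crossing diagram. -/
def Crosses (n : ℕ) (p q : ℤ × ℤ) : Prop := CrossRel n p q ∨ CrossRel n q p

/-- `p` nests over `q` in the nesting diagram (arcs written in nesting order). -/
def NestRel (n : ℕ) (p q : ℤ × ℤ) : Prop :=
  nestOrd n p.1 < nestOrd n q.1 ∧ nestOrd n q.2 < nestOrd n p.2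

/-- The two arcs `p`, `q` nest in the nesting diagram. -/
def Nests (n : ℕ) (p q : ℤ × ℤ) : Prop := NestRel n p q ∨ NestRel n q p

/-- `p` nests over `q` in the type `B` nesting diagram. -/
def NestRelB (n : ℕ) (p q : ℤ × ℤ) : Prop :=
  nestOrdB n p.1 < nestOrdB n q.1 ∧ nestOrdB n q.2 < nestOrdB n p.2

/-- The two arcs `p`, `q` nest in the type `B` nesting diagram. -/
def NestsB (n : ℕ) (p q : ℤ × ℤ) : Prop := NestRelB n p q ∨ NestRelB n q p

/-- Exceptional pairs for type `B` crossings: both arcs have positive opener and negative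
closer, and at least one closer is smaller in absolute value than its opener. -/
def ExcCross (p q : ℤ × ℤ) : Prop :=
  0 < p.1 ∧ p.2 < 0 ∧ 0 < q.1 ∧ q.2 < 0 ∧ (|p.2| < |p.1| ∨ |q.2| < |q.1|)

/-- Exceptional pairs for type `B` nestings: both arcs have positive opener (or begin at `0`)
and negative closer (or end at `0`), and at least one closer is smaller in absolute value
than its opener. -/
def ExcNest (p q : ℤ × ℤ) : Prop :=
  0 ≤ p.1 ∧ p.2 ≤ 0 ∧ 0 ≤ q.1 ∧ q.2 ≤ 0 ∧ (|p.2| < |p.1| ∨ |q.2| < |q.1|)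

/-- A block augmented by `0` if it is the zero block. -/
def augB (B : Finset ℤ) : Finset ℤ := if negSet B = B then insert 0 B else B

/-- The arc `p` contains `n`. -/
def ContainsN (n : ℕ) (p : ℤ × ℤ) : Prop := p.1 = (n : ℤ) ∨ p.2 = (n : ℤ)

/-- The arc `p` contains `-n`. -/
def ContainsNegN (n : ℕ) (p : ℤ × ℤ) : Prop := p.1 = -(n : ℤ) ∨ p.2 = -(n : ℤ)

namespace SetPartitionC

variable {n : ℕ}

/-- The ground set `[±n]` as a finset of integers. -/
def pmn (n : ℕ) : Finset ℤ := (Finset.Icc (-(n : ℤ)) (n : ℤ)).erase 0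

/-- `(i,j)` is an arc: `i`, `j` are consecutive elements of a block in the nesting order. -/
def IsArc (P : SetPartitionC n) (i j : ℤ) : Prop :=
  nestOrd n i < nestOrd n j ∧ ∃ B ∈ P.blocks, i ∈ B ∧ j ∈ B ∧
    ∀ k ∈ B, ¬(nestOrd n i < nestOrd n k ∧ nestOrd n k < nestOrd n j)

/-- The finite set of arcs of `P` (written in nesting order). -/
def arcs (P : SetPartitionC n) : Finset (ℤ × ℤ) :=
  (pmn n ×ˢ pmn n).filter fun p => P.IsArc p.1 p.2

/-- Openers: positive elements that are not maximal in their block w.r.t. the nesting order. -/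
def openers (P : SetPartitionC n) : Finset ℤ :=
  (Finset.Icc 1 (n : ℤ)).filter fun i =>
    ∃ B ∈ P.blocks, i ∈ B ∧ ∃ j ∈ B, nestOrd n i < nestOrd n j

/-- Closers: positive elements that are not minimal in their block w.r.t. the nesting order. -/
def closers (P : SetPartitionC n) : Finset ℤ :=
  (Finset.Icc 1 (n : ℤ)).filter fun i =>
    ∃ B ∈ P.blocks, i ∈ B ∧ ∃ j ∈ B, nestOrd n j < nestOrd n i

/-- The number of crossings of a type `C` set partition. -/
def crossings (P : SetPartitionC n) : ℕ :=
  ((P.arcs ×ˢ P.arcs).filter fun q => CrossRel n q.1 q.2).card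

/-- The number of nestings of a type `C` set partition. -/
def nestings (P : SetPartitionC n) : ℕ :=
  ((P.arcs ×ˢ P.arcs).filter fun q => NestRel n q.1 q.2).card

/-- The number of crossings among pairs of arcs that both have positive opener. -/
def crossingsPos (P : SetPartitionC n) : ℕ :=
  (((P.arcs.filter fun p => 0 < p.1) ×ˢ (P.arcs.filter fun p => 0 < p.1)).filter
    fun q => CrossRel n q.1 q.2).card

/-- The number of nestings among pairs of arcs that both have positive opener. -/
def nestingsPos (P : SetPartitionC n) : ℕ :=
  (((P.arcs.filter fun p => 0 < p.1) ×ˢ (P.arcs.filter fun p => 0 < p.1)).filter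
    fun q => NestRel n q.1 q.2).card

/-- The cardinality of a maximal crossing. -/
def maxCrossing (P : SetPartitionC n) : ℕ :=
  (P.arcs.powerset.filter fun S => ∀ a ∈ S, ∀ b ∈ S, a ≠ b → Crosses n a b).sup Finset.card

/-- The cardinality of a maximal nesting. -/
def maxNesting (P : SetPartitionC n) : ℕ :=
  (P.arcs.powerset.filter fun S => ∀ a ∈ S, ∀ b ∈ S, a ≠ b → Nests n a b).sup Finset.card

/-! ### Type B notions -/

/-- `(i,j)` is a type `B` nesting arc: consecutive elements of an augmented block in the
type `B` nesting order. -/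
def IsArcB (P : SetPartitionC n) (i j : ℤ) : Prop :=
  nestOrdB n i < nestOrdB n j ∧ ∃ B ∈ P.blocks, i ∈ augB B ∧ j ∈ augB B ∧
    ∀ k ∈ augB B, ¬(nestOrdB n i < nestOrdB n k ∧ nestOrdB n k < nestOrdB n j)

/-- The finite set of type `B` nesting arcs of `P`. -/
def arcsB (P : SetPartitionC n) : Finset (ℤ × ℤ) :=
  ((insert 0 (pmn n)) ×ˢ (insert 0 (pmn n))).filter fun p => P.IsArcB p.1 p.2

/-- The number of type `B` crossings. -/
def crossingsB (P : SetPartitionC n) : ℕ :=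
  ((P.arcs ×ˢ P.arcs).filter fun q => CrossRel n q.1 q.2 ∧ ¬ExcCross q.1 q.2).card

/-- The number of type `B` nestings. -/
def nestingsB (P : SetPartitionC n) : ℕ :=
  ((P.arcsB ×ˢ P.arcsB).filter fun q => NestRelB n q.1 q.2 ∧ ¬ExcNest q.1 q.2).card

/-- Openers in type `B`: positive elements not maximal in their block
w.r.t. the type `B` nesting order. -/
def openersB (P : SetPartitionC n) : Finset ℤ :=
  (Finset.Icc 1 (n : ℤ)).filter fun i =>
    ∃ B ∈ P.blocks, i ∈ B ∧ ∃ j ∈ B, nestOrdB n i < nestOrdB n j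

/-- Closers in type `B`: positive elements not minimal in their block
w.r.t. the type `B` nesting order. -/
def closersB (P : SetPartitionC n) : Finset ℤ :=
  (Finset.Icc 1 (n : ℤ)).filter fun i =>
    ∃ B ∈ P.blocks, i ∈ B ∧ ∃ j ∈ B, nestOrdB n j < nestOrdB n i

/-- The cardinality of a maximal type `B` crossing. -/
def maxCrossingB (P : SetPartitionC n) : ℕ :=
  (P.arcs.powerset.filter fun S =>
    ∀ a ∈ S, ∀ b ∈ S, a ≠ b → Crosses n a b ∧ ¬ExcCross a b).sup Finset.card

/-- The cardinality of a maximal type `B` nesting. -/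
def maxNestingB (P : SetPartitionC n) : ℕ :=
  (P.arcsB.powerset.filter fun S =>
    ∀ a ∈ S, ∀ b ∈ S, a ≠ b → NestsB n a b ∧ ¬ExcNest a b).sup Finset.card

/-! ### Type D notions -/

/-- A type `C` set partition is of type `D` if the zero block, when present, is not a single
pair `{i,-i}`. -/
def IsTypeD (P : SetPartitionC n) : Prop :=
  ∀ B ∈ P.blocks, negSet B = B → B.card ≠ 2

/-- The arcs starting in `{1,…,n-1}` and ending in the negative of an element of `{1,…,n-1}`. -/
def pnArcs (P : SetPartitionC n) : Finset (ℤ × ℤ) :=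
  P.arcs.filter fun p => 0 < p.1 ∧ p.1 < (n : ℤ) ∧ -(n : ℤ) < p.2 ∧ p.2 < 0

/-- The index `l` of an arc `a = (i_l, -j_l)` in the list of `pnArcs` ordered by openers. -/
def dRank (P : SetPartitionC n) (a : ℤ × ℤ) : ℕ :=
  (P.pnArcs.filter fun b => b.1 ≤ a.1).card

/-- The crossings allowed in a non-crossing set partition of type `D`. -/
def AllowedCrossD (P : SetPartitionC n) (p q : ℤ × ℤ) : Prop :=
  (ContainsN n p ∧ q ∈ P.pnArcs ∧ P.pnArcs.card < 2 * P.dRank q) ∨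
  (ContainsN n q ∧ p ∈ P.pnArcs ∧ P.pnArcs.card < 2 * P.dRank p) ∨
  (ContainsNegN n p ∧ q ∈ P.pnArcs ∧ 2 * P.dRank q ≤ P.pnArcs.card) ∨
  (ContainsNegN n q ∧ p ∈ P.pnArcs ∧ 2 * P.dRank p ≤ P.pnArcs.card) ∨
  (ContainsN n p ∧ ContainsNegN n q) ∨
  (ContainsN n q ∧ ContainsNegN n p)

/-- `P` is a non-crossing set partition of type `D_n`. -/
def NonCrossingD (P : SetPartitionC n) : Prop :=
  (∀ i : ℤ, 0 < i → P.IsArc i (-i) → i = n) ∧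
  (∀ p ∈ P.arcs, ∀ q ∈ P.arcs, Crosses n p q → P.AllowedCrossD p q) ∧
  (∀ p ∈ P.arcs, ContainsN n p →
    ∀ q ∈ P.pnArcs, P.pnArcs.card < 2 * P.dRank q → Crosses n p q) ∧
  (∀ p ∈ P.arcs, ContainsNegN n p →
    ∀ q ∈ P.pnArcs, 2 * P.dRank q ≤ P.pnArcs.card → Crosses n p q)

/-- The nestings (`p` over `q`) allowed in a non-nesting set partition of type `D`. -/
def AllowedNestD (P : SetPartitionC n) (p q : ℤ × ℤ) : Prop :=
  (0 < p.1 ∧ p.1 < q.1 ∧ q.1 < (n : ℤ) ∧ p.2 = -(n : ℤ) ∧ q.2 = (n : ℤ)) ∨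
  (q.1 = (n : ℤ) ∧ q.2 = -(n : ℤ) ∧ 0 < p.1 ∧ p.1 < (n : ℤ) ∧ -(n : ℤ) < p.2 ∧ p.2 < 0 ∧
    ∃ m : ℤ, 0 < m ∧ m < p.1 ∧ m < -p.2 ∧ P.IsArc m (n : ℤ))

/-- `P` is a non-nesting set partition of type `D_n`. -/
def NonNestingD (P : SetPartitionC n) : Prop :=
  (∀ i : ℤ, 0 < i → P.IsArc i (-i) → i = n) ∧
  (∀ p ∈ P.arcs, ∀ q ∈ P.arcs, NestRel n p q → P.AllowedNestD p q)

end SetPartitionC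

/-! ### The staircase polyomino and chains in fillings -/

/-- The cells of the staircase polyomino `P_n`: `(c,r)` with `1 ≤ c ≤ n`, `c ≤ r ≤ 2n-1`. -/
def cellsP (n : ℕ) : Finset (ℕ × ℕ) :=
  ((Finset.Icc 1 n) ×ˢ (Finset.Icc 1 (2 * n - 1))).filter fun p => p.1 ≤ p.2

/-- The length of the longest north-east chain among a set of (nonzero) cells:
columns strictly increase while rows strictly decrease. -/
def neLen (S : Finset (ℕ × ℕ)) : ℕ :=
  (S.powerset.filter fun T =>
    ∀ a ∈ T, ∀ b ∈ T, a ≠ b →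
      (a.1 < b.1 ∧ b.2 < a.2) ∨ (b.1 < a.1 ∧ a.2 < b.2)).sup Finset.card

/-- The length of the longest south-east chain among a set of (nonzero) cells:
columns and rows strictly increase, and the surrounding rectangle lies in the polyomino
(`a.1 ≤ b.2` for all cells `a`, `b` of the chain). -/
def seLen (S : Finset (ℕ × ℕ)) : ℕ :=
  (S.powerset.filter fun T =>
    (∀ a ∈ T, ∀ b ∈ T, a ≠ b →
      (a.1 < b.1 ∧ a.2 < b.2) ∨ (b.1 < a.1 ∧ b.2 < a.2)) ∧
    ∀ a ∈ T, ∀ b ∈ T, a.1 ≤ b.2).sup Finset.card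

namespace SetPartitionC

variable {n : ℕ}

/-- The cells filled with `1` in the nesting filling of the staircase polyomino: rows are
labelled from top to bottom by `2,…,n,-n,…,-1`; the cell in column `i` and row labelled `j`
is filled iff `(i,j)` is an arc with positive opener `i`. -/
def nestFill (P : SetPartitionC n) : Finset (ℕ × ℕ) :=
  (cellsP n).filter fun c => ∃ j : ℤ, P.IsArc (c.1 : ℤ) j ∧ nestOrd n j = (c.2 : ℤ) + 1

/-- The cells filled with `1` in the crossing filling of the staircase polyomino: rows are
labelled from top to bottom by `2,…,n,-1,…,-n`; the cell in column `i` and row labelled `j`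
is filled iff `(i,j)` is an arc with positive opener `i`. -/
def crossFill (P : SetPartitionC n) : Finset (ℕ × ℕ) :=
  (cellsP n).filter fun c => ∃ j : ℤ, P.IsArc (c.1 : ℤ) j ∧ crossOrd n j = (c.2 : ℤ) + 1

end SetPartitionC

/-! ### Triangulations of the symmetric 2n-gon and symmetric fans of Dyck paths -/

/-- `p` is a diagonal of the `2n`-gon with vertices labelled by `[±n]`, written with its two
(distinct) endpoints in crossing order. -/
def IsDiag (n : ℕ) (p : ℤ × ℤ) : Prop :=
  p.1 ≠ 0 ∧ p.2 ≠ 0 ∧ |p.1| ≤ (n : ℤ) ∧ |p.2| ≤ (n : ℤ) ∧ crossOrd n p.1 < crossOrd n p.2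

/-- Normalize a pair so that its endpoints are in crossing order. -/
def normD (n : ℕ) (p : ℤ × ℤ) : ℤ × ℤ :=
  if crossOrd n p.1 < crossOrd n p.2 then p else (p.2, p.1)

/-- `ω` contains `m` mutually crossing diagonals. -/
def HasMCross (n m : ℕ) (ω : Finset (ℤ × ℤ)) : Prop :=
  ∃ S ⊆ ω, S.card = m ∧ ∀ a ∈ S, ∀ b ∈ S, a ≠ b → Crosses n a b

/-- A type `C_n` `k`-triangulation: a symmetric set of diagonals with no `(k+1)`-crossing,
maximal with this property. -/
def IsTriangC (n k : ℕ) (ω : Finset (ℤ × ℤ)) : Prop :=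
  (∀ p ∈ ω, IsDiag n p) ∧
  (∀ p ∈ ω, normD n (-p.1, -p.2) ∈ ω) ∧
  ¬HasMCross n (k + 1) ω ∧
  ∀ d : ℤ × ℤ, IsDiag n d → d ∉ ω → HasMCross n (k + 1) (insert d ω)

/-- A Dyck path in the staircase polyomino starting at the top cell `(i,i)` of column `i`,
proceeding by unit south or west steps inside `P_n`, and ending on the main diagonal
`r = 2n - c`. -/
def IsDyckPath (n i : ℕ) (l : List (ℕ × ℕ)) : Prop :=
  l ≠ [] ∧ l.head? = some (i, i) ∧ (∀ c ∈ l, c ∈ cellsP n) ∧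
  l.Chain' (fun a b => (b.1 = a.1 ∧ b.2 = a.2 + 1) ∨ (b.1 + 1 = a.1 ∧ b.2 = a.2)) ∧
  ∀ c : ℕ × ℕ, l.getLast? = some c → c.2 = 2 * n - c.1

/-- A symmetric fan of `k` non-intersecting Dyck paths: the `i`-th path starts at cell
`(i,i)` and the paths are pairwise cell-disjoint. -/
def IsSymFan (n k : ℕ) (f : Fin k → List (ℕ × ℕ)) : Prop :=
  (∀ i : Fin k, IsDyckPath n ((i : ℕ) + 1) (f i)) ∧
  ∀ i j : Fin k, i ≠ j → ∀ c ∈ f i, c ∉ f j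

namespace GR

def F (A : ℕ → ℕ → ℕ) : ℕ → ℕ → ℕ
  | 0, _ => 0
  | _+1, 0 => 0
  | i+1, j+1 => max (F A (i+1) j) (F A i (j+1)) + A i j
termination_by i j => i + j

theorem F_zl (A : ℕ → ℕ → ℕ) (j : ℕ) : F A 0 j = 0 := by rw [F]
theorem F_zr (A : ℕ → ℕ → ℕ) (i : ℕ) : F A i 0 = 0 := by cases i <;> rw [F]
theorem F_s (A : ℕ → ℕ → ℕ) (i j : ℕ) :
    F A (i+1) (j+1) = max (F A (i+1) j) (F A i (j+1)) + A i j := by rw [F]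
theorem F_mi (A : ℕ → ℕ → ℕ) (i j : ℕ) : F A i j ≤ F A (i+1) j := by
  cases j with
  | zero => simp [F_zr]
  | succ j => rw [F_s]; omega
theorem F_mj (A : ℕ → ℕ → ℕ) (i j : ℕ) : F A i j ≤ F A i (j+1) := by
  cases i with
  | zero => simp [F_zl]
  | succ j => rw [F_s]; omega

def FA (A : ℕ → ℕ → ℕ) (i j : ℕ) : ℕ := min (F A (i+1) j) (F A i (j+1)) - F A i j

def Ft (A : ℕ → ℕ → ℕ) (s : ℕ) : ℕ → ℕ → ℕ := FA^[s] A

theorem Ft_s (A : ℕ → ℕ → ℕ) (s : ℕ) : Ft A (s+1) = FA (Ft A s) := by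
  simp [Ft, Function.iterate_succ_apply']

theorem FA_eq (A : ℕ → ℕ → ℕ) (i j : ℕ) :
    A i j + F A (i+1) j + F A i (j+1) = FA A i j + F A (i+1) (j+1) + F A i j := by
  have := F_s A i j
  have := F_mi A i j
  have := F_mj A i j
  unfold FA; omega

def H (A : ℕ → ℕ → ℕ) : ℕ → ℕ → ℕ
  | 0, _ => 0
  | _+1, 0 => 0
  | i+1, j+1 => max (max (H A (i+1) j) (H A i (j+1))) (H A i j + if A i j = 0 then 0 else 1)
termination_by i j => i + j

theorem H_zl (A : ℕ → ℕ → ℕ) (j : ℕ) : H A 0 j = 0 := by rw [H]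
theorem H_zr (A : ℕ → ℕ → ℕ) (i : ℕ) : H A i 0 = 0 := by cases i <;> rw [H]
theorem H_s (A : ℕ → ℕ → ℕ) (i j : ℕ) :
    H A (i+1) (j+1) = max (max (H A (i+1) j) (H A i (j+1)))
      (H A i j + if A i j = 0 then 0 else 1) := by rw [H]
theorem H_mi (A : ℕ → ℕ → ℕ) (i j : ℕ) : H A i j ≤ H A (i+1) j := by
  cases j with
  | zero => simp [H_zr]
  | succ j => rw [H_s]; omega
theorem H_mj (A : ℕ → ℕ → ℕ) (i j : ℕ) : H A i j ≤ H A i (j+1) := by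
  cases i with
  | zero => simp [H_zl]
  | succ j => rw [H_s]; omega
theorem H_li (A : ℕ → ℕ → ℕ) (i j : ℕ) : H A (i+1) j ≤ H A i j + 1 := by
  induction j with
  | zero => simp [H_zr]
  | succ j ih => 
    have := H_mj A i j
    rw [H_s]; split_ifs <;> omega
theorem H_lj (A : ℕ → ℕ → ℕ) (i j : ℕ) : H A i (j+1) ≤ H A i j + 1 := by
  induction i with
  | zero => simp [H_zl]
  | succ i ih => 
    have := H_mi A i j
    rw [H_s]; split_ifs <;> omega

def HA (A : ℕ → ℕ → ℕ) (i j : ℕ) : ℕ :=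
  A i j + H A (i+1) j + H A i (j+1) - H A i j - H A (i+1) (j+1)

def Ht (A : ℕ → ℕ → ℕ) (s : ℕ) : ℕ → ℕ → ℕ := HA^[s] A

theorem Ht_s (A : ℕ → ℕ → ℕ) (s : ℕ) : Ht A (s+1) = HA (Ht A s) := by
  simp [Ht, Function.iterate_succ_apply']

theorem HA_eq (A : ℕ → ℕ → ℕ) (i j : ℕ) :
    A i j + H A (i+1) j + H A i (j+1) = HA A i j + H A (i+1) (j+1) + H A i j := by
  have := H_s A i j
  have := H_mi A i j
  have := H_mj A i j
  have := H_li A i j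
  have := H_lj A i j
  unfold HA; split_ifs at * <;> omega

theorem H_anti (A : ℕ → ℕ → ℕ) : ∀ i j, H (HA A) i j ≤ H A i j := by
  intro i
  induction i with
  | zero => intro j; simp [H_zl]
  | succ i ihi =>
    intro j
    induction j with
    | zero => simp [H_zr]
    | succ j ihj =>
      have h1 := ihi j
      have h2 := ihi (j+1)
      have := H_s A i j
      have := H_s (HA A) i j
      have := H_mi A i j
      have := H_mj A i j
      have := HA_eq A i j
      split_ifs at * <;> omega

/-! sums -/
def T (A : ℕ → ℕ → ℕ) (I J : ℕ) : ℕ := ∑ i ∈ Finset.range I, ∑ j ∈ Finset.range J, A i j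

theorem T_step (A A' G : ℕ → ℕ → ℕ) (hl : ∀ j, G 0 j = 0) (hr : ∀ i, G i 0 = 0)
    (h : ∀ i j, A i j + G (i+1) j + G i (j+1) = A' i j + G (i+1) (j+1) + G i j) (I J : ℕ) :
    T A I J = T A' I J + G I J := by
  have col : ∀ i, ∑ j ∈ Finset.range J, A i j + G i J = ∑ j ∈ Finset.range J, A' i j + G (i+1) J := by
    intro i
    induction J with
    | zero => simp [hr]
    | succ J ih =>
      rw [Finset.sum_range_succ, Finset.sum_range_succ]
      have := h i J
      omega
  unfold T
  induction I with
  | zero => simp [hl]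
  | succ I ih =>
    rw [Finset.sum_range_succ, Finset.sum_range_succ]
    have := col I
    omega

theorem T_F (A : ℕ → ℕ → ℕ) (I J N : ℕ) :
    T A I J = T (Ft A N) I J + ∑ s ∈ Finset.range N, F (Ft A s) I J := by
  induction N with
  | zero => simp [Ft]
  | succ N ih =>
    rw [ih, Finset.sum_range_succ, Ft_s,
      T_step (Ft A N) (FA (Ft A N)) (F (Ft A N)) (F_zl _) (F_zr _) (FA_eq _)]
    omega

theorem T_H (A : ℕ → ℕ → ℕ) (I J N : ℕ) :
    T A I J = T (Ht A N) I J + ∑ s ∈ Finset.range N, H (Ht A s) I J := by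
  induction N with
  | zero => simp [Ht]
  | succ N ih =>
    rw [ih, Finset.sum_range_succ, Ht_s,
      T_step (Ht A N) (HA (Ht A N)) (H (Ht A N)) (H_zl _) (H_zr _) (HA_eq _)]
    omega

theorem F_mono (A : ℕ → ℕ → ℕ) {i i' j j' : ℕ} (hi : i ≤ i') (hj : j ≤ j') : F A i j ≤ F A i' j' :=
  le_trans (monotone_nat_of_le_succ (f := fun i => F A i j) (fun i => F_mi A i j) hi)
    (monotone_nat_of_le_succ (f := fun j => F A i' j) (fun j => F_mj A i' j) hj)

theorem H_mono (A : ℕ → ℕ → ℕ) {i i' j j' : ℕ} (hi : i ≤ i') (hj : j ≤ j') : H A i j ≤ H A i' j' :=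
  le_trans (monotone_nat_of_le_succ (f := fun i => H A i j) (fun i => H_mi A i j) hi)
    (monotone_nat_of_le_succ (f := fun j => H A i' j) (fun j => H_mj A i' j) hj)

theorem F_zero (A : ℕ → ℕ → ℕ) {I J : ℕ} (h : F A I J = 0) {i j : ℕ} (hi : i < I) (hj : j < J) :
    A i j = 0 := by
  have := F_mono A (show i+1 ≤ I from hi) (show j+1 ≤ J from hj)
  have := F_s A i j
  omega

theorem H_zero (A : ℕ → ℕ → ℕ) {I J : ℕ} (h : H A I J = 0) {i j : ℕ} (hi : i < I) (hj : j < J) :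
    A i j = 0 := by
  have := H_mono A (show i+1 ≤ I from hi) (show j+1 ≤ J from hj)
  have := H_s A i j
  split_ifs at * <;> omega

theorem T_zero (A : ℕ → ℕ → ℕ) (I J : ℕ) (h : ∀ i < I, ∀ j < J, A i j = 0) : T A I J = 0 := by
  unfold T
  refine Finset.sum_eq_zero fun i hi => Finset.sum_eq_zero fun j hj => ?_
  exact h i (by simpa using hi) j (by simpa using hj)

theorem Ht_anti (A : ℕ → ℕ → ℕ) (i j : ℕ) : Antitone fun s => H (Ht A s) i j := by
  refine antitone_nat_of_succ_le fun s => ?_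
  rw [Ht_s]; exact H_anti _ _ _

theorem Ht_ev (A : ℕ → ℕ → ℕ) (i j : ℕ) : ∃ N, ∀ s ≥ N, H (Ht A s) i j = 0 := by
  refine ⟨T A i j, fun s hs => ?_⟩
  by_contra hne
  have h1 := T_H A i j (s+1)
  have h2 : ∑ t ∈ Finset.range (s+1), 1 ≤ ∑ t ∈ Finset.range (s+1), H (Ht A t) i j := by
    refine Finset.sum_le_sum fun t ht => ?_
    have := Ht_anti A i j (show t ≤ s by simp at ht; omega)
    simp only at this
    omega
  simp at h2
  omega

/-! conjugation -/
def conj (h : ℕ → ℕ) (s : ℕ) : ℕ := sInf {t | h t ≤ s}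

theorem lt_conj {h : ℕ → ℕ} (ha : Antitone h) (hz : ∃ N, ∀ s ≥ N, h s = 0) (s t : ℕ) :
    t < conj h s ↔ s < h t := by
  constructor
  · intro hh
    have := Nat.notMem_of_lt_sInf hh
    simpa using this
  · intro hh
    by_contra hc
    obtain ⟨N, hN⟩ := hz
    have hm : conj h s ∈ {t | h t ≤ s} := Nat.sInf_mem ⟨N, by simp [hN]⟩
    have h2 : h t ≤ h (conj h s) := ha (by omega)
    have h3 : h (conj h s) ≤ s := hm
    omega

theorem conj_sum {h f : ℕ → ℕ} (hf : ∀ s t, t < f s ↔ s < h t) {N M : ℕ} (hN : h N = 0) (hM : f M = 0) :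
    ∑ t ∈ Finset.range N, h t = ∑ s ∈ Finset.range M, f s := by
  have e1 : ∀ t, h t = ∑ s ∈ Finset.range M, if s < h t then 1 else 0 := by
    intro t
    have : ¬ M < h t := by rw [← hf]; omega
    rw [← Finset.card_filter]
    have : (Finset.range M).filter (fun s => s < h t) = Finset.range (h t) := by
      ext x; simp; omega
    rw [this]; simp
  have e2 : ∀ s, f s = ∑ t ∈ Finset.range N, if s < h t then 1 else 0 := by
    intro s
    have : ¬ N < f s := by rw [hf]; omega
    rw [← Finset.card_filter]
    have : (Finset.range N).filter (fun t => s < h t) = Finset.range (f s) := by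
      ext x; simp only [Finset.mem_filter, Finset.mem_range, ← hf]; omega
    rw [this]; simp
  rw [Finset.sum_congr rfl fun t _ => e1 t, Finset.sum_congr rfl fun t _ => e2 t, Finset.sum_comm]

def Int (f g : ℕ → ℕ) : Prop := ∀ s, g (s+1) ≤ f s ∧ f s ≤ g s

theorem conj_int {h h' f f' : ℕ → ℕ} (hf : ∀ s t, t < f s ↔ s < h t) (hf' : ∀ s t, t < f' s ↔ s < h' t)
    (h1 : ∀ t, h t ≤ h' t) (h2 : ∀ t, h' t ≤ h t + 1) : Int f f' := by
  intro s
  constructor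
  · by_contra hc
    push Not at hc
    have a := (hf' (s+1) (f s)).1 hc
    have b := h2 (f s)
    have c := (hf s (f s)).2 (by omega)
    omega
  · by_contra hc
    push Not at hc
    have a := (hf s (f' s)).1 hc
    have b := h1 (f' s)
    have c := (hf' s (f' s)).2 (by omega)
    omega

def sg (A : ℕ → ℕ → ℕ) (i j : ℕ) : ℕ → ℕ := conj (fun t => H (Ht A t) i j)

theorem lt_sg (A : ℕ → ℕ → ℕ) (i j s t : ℕ) : t < sg A i j s ↔ s < H (Ht A t) i j :=
  lt_conj (Ht_anti A i j) (Ht_ev A i j) s t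

theorem sg_int (A : ℕ → ℕ → ℕ) (i j : ℕ) :
    Int (sg A i j) (sg A (i+1) j) ∧ Int (sg A i j) (sg A i (j+1)) :=
  ⟨conj_int (lt_sg A i j) (lt_sg A (i+1) j) (fun t => H_mi _ _ _) (fun t => H_li _ _ _),
   conj_int (lt_sg A i j) (lt_sg A i (j+1)) (fun t => H_mj _ _ _) (fun t => H_lj _ _ _)⟩

theorem sg_zl (A : ℕ → ℕ → ℕ) (j s : ℕ) : sg A 0 j s = 0 := by
  by_contra h
  have := (lt_sg A 0 j s 0).1 (by omega)
  rw [H_zl] at this; omega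
theorem sg_zr (A : ℕ → ℕ → ℕ) (j s : ℕ) : sg A j 0 s = 0 := by
  by_contra h
  have := (lt_sg A j 0 s 0).1 (by omega)
  rw [H_zr] at this; omega

/-! backward recursion -/
def back (D : ℕ → ℕ → Prop) (N : ℕ) (σ : ℕ → ℕ → ℕ → ℕ) (i j : ℕ) : ℕ → ℕ :=
  if _h : D i j ∧ i + j < N then fun s =>
    min (back D N σ (i+1) j s) (back D N σ i (j+1) s) -
      (back D N σ (i+1) (j+1) (s+1) - max (back D N σ (i+1) j (s+1)) (back D N σ i (j+1) (s+1)))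
  else σ i j
termination_by N - (i + j)

structure Good (D : ℕ → ℕ → Prop) (N : ℕ) : Prop where
  di : ∀ i j, D (i+1) j → D i j
  dj : ∀ i j, D i (j+1) → D i j
  bd : ∀ i j, D i j → i + j < N

theorem back_out {D : ℕ → ℕ → Prop} {N : ℕ} (σ : ℕ → ℕ → ℕ → ℕ) {i j : ℕ}
    (h : ¬ D i j) : back D N σ i j = σ i j := by
  rw [back]; simp [h]
theorem back_in {D : ℕ → ℕ → Prop} {N : ℕ} (g : Good D N) (σ : ℕ → ℕ → ℕ → ℕ) {i j : ℕ}
    (h : D i j) (s : ℕ) : back D N σ i j s = min (back D N σ (i+1) j s) (back D N σ i (j+1) s) -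
      (back D N σ (i+1) (j+1) (s+1) - max (back D N σ (i+1) j (s+1)) (back D N σ i (j+1) (s+1))) := by
  conv_lhs => rw [back]
  simp [h, g.bd i j h]

theorem back_int {D : ℕ → ℕ → Prop} {N : ℕ} (g : Good D N) (σ : ℕ → ℕ → ℕ → ℕ)
    (hs : ∀ i j, Int (σ i j) (σ (i+1) j) ∧ Int (σ i j) (σ i (j+1))) :
    ∀ d i j, N - (i + j) ≤ d → Int (back D N σ i j) (back D N σ (i+1) j) ∧
      Int (back D N σ i j) (back D N σ i (j+1)) := by
  have out : ∀ i j, ¬ D i j → Int (back D N σ i j) (back D N σ (i+1) j) ∧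
      Int (back D N σ i j) (back D N σ i (j+1)) := by
    intro i j h
    rw [back_out σ h, back_out σ (fun h' => h (g.di _ _ h')), back_out σ (fun h' => h (g.dj _ _ h'))]
    exact hs i j
  intro d
  induction d with
  | zero =>
    intro i j hd
    exact out i j fun h => by have := g.bd i j h; omega
  | succ d ih =>
    intro i j hd
    by_cases h : D i j
    · have hN := g.bd i j h
      have h1 := (ih (i+1) j (by omega)).2
      have h2 := (ih i (j+1) (by omega)).1
      constructor <;> intro s
      all_goals
        have a := h1 s
        have b := h2 s
        have c := h1 (s+1)
        have e := h2 (s+1)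
        have f := back_in g σ h s
        omega
    · exact out i j h

theorem back_int' {D : ℕ → ℕ → Prop} {N : ℕ} (g : Good D N) (σ : ℕ → ℕ → ℕ → ℕ)
    (hs : ∀ i j, Int (σ i j) (σ (i+1) j) ∧ Int (σ i j) (σ i (j+1))) (i j : ℕ) :
    Int (back D N σ i j) (back D N σ (i+1) j) ∧
      Int (back D N σ i j) (back D N σ i (j+1)) := back_int g σ hs _ i j le_rfl

theorem back_zl {D : ℕ → ℕ → Prop} {N : ℕ} (g : Good D N) (σ : ℕ → ℕ → ℕ → ℕ)
    (hs : ∀ i j, Int (σ i j) (σ (i+1) j) ∧ Int (σ i j) (σ i (j+1)))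
    (hz : ∀ j s, σ 0 j s = 0) : ∀ d j s, N - j ≤ d → back D N σ 0 j s = 0 := by
  intro d
  induction d with
  | zero =>
    intro j s hd
    rw [back_out σ, hz]
    intro h; have := g.bd _ _ h; omega
  | succ d ih =>
    intro j s hd
    by_cases h : D 0 j
    · have := g.bd _ _ h
      have := ih (j+1) s (by omega)
      have := ((back_int' g σ hs 0 j).2 s).2
      omega
    · rw [back_out σ h, hz]

theorem back_zr {D : ℕ → ℕ → Prop} {N : ℕ} (g : Good D N) (σ : ℕ → ℕ → ℕ → ℕ)
    (hs : ∀ i j, Int (σ i j) (σ (i+1) j) ∧ Int (σ i j) (σ i (j+1)))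
    (hz : ∀ j s, σ j 0 s = 0) : ∀ d j s, N - j ≤ d → back D N σ j 0 s = 0 := by
  intro d
  induction d with
  | zero =>
    intro j s hd
    rw [back_out σ, hz]
    intro h; have := g.bd _ _ h; omega
  | succ d ih =>
    intro j s hd
    by_cases h : D j 0
    · have := g.bd _ _ h
      have := ih (j+1) s (by omega)
      have := ((back_int' g σ hs j 0).1 s).2
      omega
    · rw [back_out σ h, hz]

def Phi (D : ℕ → ℕ → Prop) (N : ℕ) (A : ℕ → ℕ → ℕ) (i j : ℕ) : ℕ :=
  if D i j then back D N (sg A) (i+1) (j+1) 0 -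
    max (back D N (sg A) (i+1) j 0) (back D N (sg A) i (j+1) 0) else 0

/-- closure vertices -/
def Cl (D : ℕ → ℕ → Prop) : ℕ → ℕ → Prop
  | 0, _ => True
  | _+1, 0 => True
  | i+1, j+1 => D i j

theorem Cl_of {D : ℕ → ℕ → Prop} {N : ℕ} (g : Good D N) {i j : ℕ} (h : D i j) :
    Cl D i j ∧ Cl D (i+1) j ∧ Cl D i (j+1) := by
  refine ⟨?_, ?_, ?_⟩
  · cases i <;> cases j <;> simp only [Cl]
    exact g.di _ _ (g.dj _ _ h)
  · cases j <;> simp only [Cl]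
    exact (g.dj _ _ h)
  · cases i <;> simp only [Cl]
    exact (g.di _ _ h)

theorem F_Phi {D : ℕ → ℕ → Prop} {N : ℕ} (g : Good D N) (A : ℕ → ℕ → ℕ) :
    ∀ d i j, i + j ≤ d → Cl D i j → ∀ s, F (Ft (Phi D N A) s) i j = back D N (sg A) i j s := by
  intro d
  have zl := back_zl g (sg A) (sg_int A) (sg_zl A)
  have zr := back_zr g (sg A) (sg_int A) (sg_zr A)
  induction d with
  | zero =>
    intro i j hd hc s
    obtain rfl : i = 0 := by omega
    rw [F_zl, zl _ _ _ le_rfl]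
  | succ d ih =>
    intro i j hd hc s
    rcases i with _ | i
    · rw [F_zl, zl _ _ _ le_rfl]
    rcases j with _ | j
    · rw [F_zr, zr _ _ _ le_rfl]
    have hD : D i j := hc
    obtain ⟨c1, c2, c3⟩ := Cl_of g hD
    rw [F_s, ih _ _ (by omega) c2, ih _ _ (by omega) c3]
    have i1 := (back_int' g (sg A) (sg_int A) (i+1) j).2
    have i2 := (back_int' g (sg A) (sg_int A) i (j+1)).1
    cases s with
    | zero =>
      have := i1 0
      have := i2 0
      simp only [Ft, Function.iterate_zero, id, Phi, hD, if_true]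
      omega
    | succ s =>
      rw [Ft_s, FA, ih _ _ (by omega) c2, ih _ _ (by omega) c3, ih _ _ (by omega) c1]
      have := i1 s
      have := i2 s
      have := i1 (s+1)
      have := i2 (s+1)
      have := back_in g (sg A) hD s
      omega

theorem F_Phi' {D : ℕ → ℕ → Prop} {N : ℕ} (g : Good D N) (A : ℕ → ℕ → ℕ) {i j : ℕ}
    (hc : Cl D i j) (ho : ¬ D i j) (s : ℕ) : F (Ft (Phi D N A) s) i j = sg A i j s := by
  rw [F_Phi g A _ i j le_rfl hc, back_out _ ho]

theorem T_Phi {D : ℕ → ℕ → Prop} {N : ℕ} (g : Good D N) (A : ℕ → ℕ → ℕ) {i j : ℕ}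
    (hc : Cl D i j) (ho : ¬ D i j) : T (Phi D N A) i j = T A i j := by
  obtain ⟨K, hK⟩ := Ht_ev A i j
  have hM : sg A i j (H (Ht A 0) i j) = 0 := by
    by_contra h
    have := (lt_sg A i j (H (Ht A 0) i j) 0).1 (by omega)
    omega
  have e := conj_sum (lt_sg A i j) (hK K le_rfl) hM
  rw [T_H A i j K, T_zero (Ht A K) i j fun a ha b hb => H_zero _ (hK K le_rfl) ha hb, e,
    T_F _ i j (H (Ht A 0) i j), T_zero (Ft (Phi D N A) _) i j fun a ha b hb =>
      F_zero _ (by rw [F_Phi' g A hc ho, hM]) ha hb]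
  simp only [F_Phi' g A hc ho]

/-! injectivity -/
theorem H_inj {D : ℕ → ℕ → Prop} {N : ℕ} (g : Good D N) (A A' : ℕ → ℕ → ℕ)
    (hb : ∀ i j, Cl D i j → ¬ D i j → ∀ s, H (Ht A s) i j = H (Ht A' s) i j) :
    ∀ d i j, N - (i + j) ≤ d → Cl D i j → (D i j → A i j = A' i j) ∧
      ∀ s, H (Ht A s) i j = H (Ht A' s) i j := by
  intro d
  induction d with
  | zero =>
    intro i j hd hc
    have hD : ¬ D i j := fun h => by have := g.bd i j h; omega
    exact ⟨fun h => absurd h hD, hb i j hc hD⟩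
  | succ d ih =>
    intro i j hd hc
    by_cases hD : D i j
    · obtain ⟨c1, c2, c3⟩ := Cl_of g hD
      have hN := g.bd i j hD
      have e1 := (ih (i+1) j (by omega) c2).2
      have e2 := (ih i (j+1) (by omega) c3).2
      have e3 := (ih (i+1) (j+1) (by omega) hD).2
      have step : ∀ s, Ht A (s+1) i j = Ht A' (s+1) i j →
          Ht A s i j = Ht A' s i j ∧ H (Ht A s) i j = H (Ht A' s) i j := by
        intro s hs
        rw [Ht_s, Ht_s] at hs
        have := HA_eq (Ht A s) i j
        have := HA_eq (Ht A' s) i j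
        have := H_s (Ht A s) i j
        have := H_s (Ht A' s) i j
        have := H_mi (Ht A s) i j
        have := H_mi (Ht A' s) i j
        have := H_mj (Ht A s) i j
        have := H_mj (Ht A' s) i j
        have := H_li (Ht A s) i j
        have := H_li (Ht A' s) i j
        have := H_lj (Ht A s) i j
        have := H_lj (Ht A' s) i j
        have := e1 s
        have := e2 s
        have := e3 s
        split_ifs at * <;> omega
      obtain ⟨K, hK⟩ := Ht_ev A (i+1) (j+1)
      have big : ∀ s, Ht A s i j = Ht A' s i j := by
        intro s
        by_contra hne
        have up : ∀ t, Ht A (s+t) i j ≠ Ht A' (s+t) i j := by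
          intro t
          induction t with
          | zero => exact hne
          | succ t iht => exact fun h => iht (step _ h).1
        apply up K
        have z1 := hK (s+K) (by omega)
        rw [H_zero _ z1 (Nat.lt_succ_self i) (Nat.lt_succ_self j)]
        rw [e3] at z1
        rw [H_zero _ z1 (Nat.lt_succ_self i) (Nat.lt_succ_self j)]
      exact ⟨fun _ => big 0, fun s => (step s (big (s+1))).2⟩
    · exact ⟨fun h => absurd h hD, hb i j hc hD⟩

theorem Phi_inj {D : ℕ → ℕ → Prop} {N : ℕ} (g : Good D N) (A A' : ℕ → ℕ → ℕ)
    (hA : ∀ i j, ¬ D i j → A i j = 0) (hA' : ∀ i j, ¬ D i j → A' i j = 0)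
    (h : Phi D N A = Phi D N A') : A = A' := by
  funext i j
  by_cases hD : D i j
  · refine (H_inj g A A' ?_ _ i j le_rfl (Cl_of g hD).1).1 hD
    intro i j hc ho s
    have e : sg A i j = sg A' i j := by
      funext s; rw [← F_Phi' g A hc ho, h, F_Phi' g A' hc ho]
    refine le_antisymm ?_ ?_
    · by_contra hlt
      push Not at hlt
      have := (lt_sg A i j _ s).2 hlt
      rw [e, lt_sg] at this; omega
    · by_contra hlt
      push Not at hlt
      have := (lt_sg A' i j _ s).2 hlt
      rw [← e, lt_sg] at this; omega
  · rw [hA i j hD, hA' i j hD]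

/-! chains -/
def NEc (A : ℕ → ℕ → ℕ) (I J k : ℕ) : Prop := ∃ c r : ℕ → ℕ,
  (∀ t < k, c t < I ∧ r t < J ∧ A (c t) (r t) ≠ 0) ∧
  ∀ t, t + 1 < k → c t < c (t+1) ∧ r t < r (t+1)
def SEc (A : ℕ → ℕ → ℕ) (I J k : ℕ) : Prop := ∃ c r : ℕ → ℕ,
  (∀ t < k, c t < I ∧ r t < J ∧ A (c t) (r t) ≠ 0) ∧
  ∀ t, t + 1 < k → c t < c (t+1) ∧ r (t+1) < r t

theorem NEc_le (A : ℕ → ℕ → ℕ) (k : ℕ) : ∀ I J, NEc A I J k → k ≤ H A I J := by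
  induction k with
  | zero => intros; omega
  | succ k ih =>
    rintro I J ⟨c, r, h1, h2⟩
    obtain ⟨a1, a2, a3⟩ := h1 k (by omega)
    have hc : ∀ d t, t + d + 1 = k → c t < c k ∧ r t < r k := by
      intro d
      induction d with
      | zero => intro t ht; have := h2 t (by omega); rwa [show t + 1 = k by omega] at this
      | succ d ihd =>
        intro t ht
        have := ihd (t+1) (by omega)
        have := h2 t (by omega)
        omega
    have := ih (c k) (r k) ⟨c, r, fun t ht => ⟨(hc (k - t - 1) t (by omega)).1,
      (hc (k - t - 1) t (by omega)).2, (h1 t (by omega)).2.2⟩, fun t ht => h2 t (by omega)⟩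
    have e := H_s A (c k) (r k)
    rw [if_neg a3] at e
    have := H_mono A (show c k + 1 ≤ I from a1) (show r k + 1 ≤ J from a2)
    omega

theorem le_NEc (A : ℕ → ℕ → ℕ) : ∀ I J k, k ≤ H A I J → NEc A I J k := by
  have z : ∀ I J, NEc A I J 0 := fun I J => ⟨id, id, by simp, by simp⟩
  intro I
  induction I with
  | zero => intro J k hk; rw [H_zl] at hk; obtain rfl : k = 0 := by omega
            exact z _ _
  | succ I ihI =>
    intro J
    induction J with
    | zero => intro k hk; rw [H_zr] at hk; obtain rfl : k = 0 := by omega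
              exact z _ _
    | succ J ihJ =>
      intro k hk
      have e := H_s A I J
      by_cases h1 : k ≤ H A (I+1) J
      · obtain ⟨c, r, a, b⟩ := ihJ k h1
        exact ⟨c, r, fun t ht => ⟨(a t ht).1, by have := (a t ht).2.1; omega, (a t ht).2.2⟩, b⟩
      by_cases h2 : k ≤ H A I (J+1)
      · obtain ⟨c, r, a, b⟩ := ihI _ k h2
        exact ⟨c, r, fun t ht => ⟨by have := (a t ht).1; omega, (a t ht).2⟩, b⟩
      have hm := H_mi A I J
      have hA : A I J ≠ 0 := by
        intro h0; rw [if_pos h0] at e; omega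
      rw [if_neg hA] at e
      obtain ⟨c, r, a, b⟩ := ihI J (k-1) (by omega)
      refine ⟨fun t => if t + 1 < k then c t else I, fun t => if t + 1 < k then r t else J, ?_, ?_⟩
      · intro t ht
        by_cases h : t + 1 < k
        · have := a t (by omega)
          simp only [h, if_true]
          exact ⟨by omega, by omega, this.2.2⟩
        · simp only [h, if_false]
          exact ⟨by omega, by omega, hA⟩
      · intro t ht
        have h0 := a t (by omega)
        by_cases h : t + 1 + 1 < k
        · simp only [h, ht, if_true]
          exact b t (by omega)
        · simp only [h, ht, if_true, if_false]
          omega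

theorem NEc_iff (A : ℕ → ℕ → ℕ) (I J k : ℕ) : NEc A I J k ↔ k ≤ H A I J :=
  ⟨NEc_le A k I J, le_NEc A I J k⟩

theorem btw1 (A : ℕ → ℕ → ℕ) {i1 i2 j1 j2 : ℕ} (hi : i1 < i2) (hj : j2 < j1)
    (h1 : A i1 j1 ≠ 0) (h2 : A i2 j2 ≠ 0) :
    ∃ i j, i1 < i ∧ i ≤ i2 ∧ j2 < j ∧ j ≤ j1 ∧ FA A i j ≠ 0 := by
  by_contra hc
  push Not at hc
  have row : ∀ i, i1 + 1 ≤ i → i ≤ i2 → F A i j1 < F A i (j1+1) := by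
    intro i hi1
    induction i, hi1 using Nat.le_induction with
    | base => intro _; have := F_s A i1 j1; omega
    | succ i hi1 ih =>
      intro hi2
      have := ih (by omega)
      have z := hc i j1 (by omega) (by omega) hj le_rfl
      unfold FA at z
      have := F_s A i j1
      have := F_mi A i j1
      omega
  have col : ∀ j, j2 + 1 ≤ j → j ≤ j1 → F A i2 j < F A (i2+1) j := by
    intro j hj1
    induction j, hj1 using Nat.le_induction with
    | base => intro _; have := F_s A i2 j2; omega
    | succ j hj1 ih =>
      intro hj2
      have := ih (by omega)
      have z := hc i2 j (by omega) (by omega) (by omega) (by omega)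
      unfold FA at z
      have := F_s A i2 j
      have := F_mj A i2 j
      omega
  have a := row i2 hi le_rfl
  have b := col j1 hj le_rfl
  have z := hc i2 j1 hi le_rfl hj le_rfl
  unfold FA at z
  omega

theorem btw2 (A : ℕ → ℕ → ℕ) {i1 i2 j1 j2 : ℕ} (hi : i1 < i2) (hj : j2 < j1)
    (h1 : FA A i1 j1 ≠ 0) (h2 : FA A i2 j2 ≠ 0) :
    ∃ i j, i1 ≤ i ∧ i < i2 ∧ j2 ≤ j ∧ j < j1 ∧ A i j ≠ 0 := by
  by_contra hc
  push Not at hc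
  have row : ∀ d i, i + d = i2 → i1 < i → F A i j2 < F A i (j2+1) := by
    intro d
    induction d with
    | zero => 
      intro i hd _
      obtain rfl : i = i2 := by omega
      unfold FA at h2; omega
    | succ d ih =>
      intro i hd hi1
      have := ih (i+1) (by omega) (by omega)
      have z := hc i j2 (by omega) (by omega) (by omega) (by omega)
      have := F_s A i j2
      have := F_mi A i j2
      omega
  have col : ∀ d j, j + d = j1 → j2 < j → F A i1 j < F A (i1+1) j := by
    intro d
    induction d with
    | zero => 
      intro j hd _
      obtain rfl : j = j1 := by omega
      unfold FA at h1; omega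
    | succ d ih =>
      intro j hd hj1
      have := ih (j+1) (by omega) (by omega)
      have z := hc i1 j (by omega) (by omega) (by omega) (by omega)
      have := F_s A i1 j
      have := F_mj A i1 j
      omega
  have a := row (i2 - (i1+1)) (i1+1) (by omega) (by omega)
  have b := col (j1 - (j2+1)) (j2+1) (by omega) (by omega)
  have z := hc i1 j2 le_rfl hi le_rfl hj
  have := F_s A i1 j2
  omega

theorem left_pt (A : ℕ → ℕ → ℕ) (j : ℕ) : ∀ i, F A i j < F A i (j+1) → ∃ i' < i, A i' j ≠ 0 := by
  intro i
  induction i with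
  | zero => simp [F_zl]
  | succ i ih =>
    intro h
    by_cases z : A i j = 0
    · have := F_s A i j
      have := F_mi A i j
      obtain ⟨i', a, b⟩ := ih (by omega)
      exact ⟨i', by omega, b⟩
    · exact ⟨i, by omega, z⟩

theorem low_pt (A : ℕ → ℕ → ℕ) (i : ℕ) : ∀ j, F A i j < F A (i+1) j → ∃ j' < j, A i j' ≠ 0 := by
  intro j
  induction j with
  | zero => simp [F_zr]
  | succ j ih =>
    intro h
    by_cases z : A i j = 0
    · have := F_s A i j
      have := F_mj A i j
      obtain ⟨j', a, b⟩ := ih (by omega)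
      exact ⟨j', by omega, b⟩
    · exact ⟨j, by omega, z⟩

theorem SEc_step (A : ℕ → ℕ → ℕ) (I J k : ℕ) : SEc A I J (k+2) ↔ SEc (FA A) I J (k+1) := by
  constructor
  · rintro ⟨c, r, h1, h2⟩
    have : ∀ t, ∃ p : ℕ × ℕ, t < k + 1 → c t < p.1 ∧ p.1 ≤ c (t+1) ∧ r (t+1) < p.2 ∧ p.2 ≤ r t ∧
        FA A p.1 p.2 ≠ 0 := by
      intro t
      by_cases ht : t < k + 1
      · obtain ⟨i, j, h⟩ := btw1 A (h2 t (by omega)).1 (h2 t (by omega)).2 (h1 t (by omega)).2.2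
          (h1 (t+1) (by omega)).2.2
        exact ⟨(i, j), fun _ => h⟩
      · exact ⟨(0,0), fun h => absurd h ht⟩
    choose p hp using this
    refine ⟨fun t => (p t).1, fun t => (p t).2, ?_, ?_⟩
    · intro t ht
      have := hp t ht
      have := h1 t (by omega)
      have := h1 (t+1) (by omega)
      refine ⟨?_, ?_, (hp t ht).2.2.2.2⟩ <;> simp only <;> omega
    · intro t ht
      have := hp t (by omega)
      have := hp (t+1) (by omega)
      simp only; omega
  · rintro ⟨c, r, h1, h2⟩
    have : ∀ t, ∃ p : ℕ × ℕ, t < k → c t ≤ p.1 ∧ p.1 < c (t+1) ∧ r (t+1) ≤ p.2 ∧ p.2 < r t ∧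
        A p.1 p.2 ≠ 0 := by
      intro t
      by_cases ht : t < k
      · obtain ⟨i, j, h⟩ := btw2 A (h2 t (by omega)).1 (h2 t (by omega)).2 (h1 t (by omega)).2.2
          (h1 (t+1) (by omega)).2.2
        exact ⟨(i, j), fun _ => h⟩
      · exact ⟨(0,0), fun h => absurd h ht⟩
    choose p hp using this
    have z0 := (h1 0 (by omega)).2.2
    have zk := (h1 k (by omega)).2.2
    unfold FA at z0 zk
    obtain ⟨i0, hi0, ha0⟩ := left_pt A (r 0) (c 0) (by omega)
    obtain ⟨jk, hjk, hak⟩ := low_pt A (c k) (r k) (by omega)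
    let q : ℕ → ℕ × ℕ := fun t => match t with
      | 0 => (i0, r 0)
      | t+1 => if t < k then p t else (c k, jk)
    have q0 : q 0 = (i0, r 0) := rfl
    have q1 : ∀ t < k, q (t+1) = p t := fun t ht => by simp [q, ht]
    have q2 : q (k+1) = (c k, jk) := by simp [q]
    refine ⟨fun t => (q t).1, fun t => (q t).2, ?_, ?_⟩
    · intro t ht
      rcases t with _ | t
      · have := h1 0 (by omega)
        simp only [q0]
        exact ⟨by omega, by omega, ha0⟩
      · by_cases htk : t < k
        · have := h1 t (by omega)
          have := h1 (t+1) (by omega)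
          have a := hp t htk
          simp only [q1 t htk]
          exact ⟨by omega, by omega, a.2.2.2.2⟩
        · obtain rfl : t = k := by omega
          have := h1 t (by omega)
          simp only [q2]
          exact ⟨by omega, by omega, hak⟩
    · intro t ht
      rcases t with _ | t
      · by_cases h0 : 0 < k
        · have := hp 0 h0
          simp only [q0, q1 0 h0]
          omega
        · obtain rfl : k = 0 := by omega
          simp only [q0, q2]; omega
      · by_cases htk : t + 1 < k
        · have := hp t (by omega)
          have := hp (t+1) htk
          simp only [q1 t (by omega), q1 (t+1) htk]
          omega
        · obtain rfl : t + 1 = k := by omega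
          have := hp t (by omega)
          simp only [q1 t (by omega), q2]
          omega

theorem SEc_one (A : ℕ → ℕ → ℕ) (I J : ℕ) : SEc A I J 1 ↔ 0 < F A I J := by
  constructor
  · rintro ⟨c, r, h1, -⟩
    obtain ⟨a, b, e⟩ := h1 0 (by omega)
    by_contra h
    exact e (F_zero A (by omega) a b)
  · intro h
    have : ∃ i < I, ∃ j < J, A i j ≠ 0 := by
      by_contra hc
      push Not at hc
      have key : ∀ i ≤ I, ∀ j ≤ J, F A i j = 0 := by
        intro i
        induction i with
        | zero => intros; exact F_zl _ _
        | succ i ihi =>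
          intro hi j
          induction j with
          | zero => intros; exact F_zr _ _
          | succ j ihj =>
            intro hj
            rw [F_s, ihj (by omega), ihi (by omega) _ hj, hc i (by omega) j (by omega)]
            rfl
      have := key I le_rfl J le_rfl
      omega
    obtain ⟨i, hi, j, hj, e⟩ := this
    exact ⟨fun _ => i, fun _ => j, fun t _ => ⟨hi, hj, e⟩, fun t ht => by omega⟩

theorem SEc_iff (I J k : ℕ) : ∀ A : ℕ → ℕ → ℕ, SEc A I J (k+1) ↔ 0 < F (Ft A k) I J := by
  induction k with
  | zero => intro A; exact SEc_one A I J
  | succ k ih =>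
    intro A
    rw [SEc_step, ih]
    rfl

theorem Phi_chain {D : ℕ → ℕ → Prop} {N : ℕ} (g : Good D N) (A : ℕ → ℕ → ℕ) {i j : ℕ}
    (hc : Cl D i j) (ho : ¬ D i j) (k : ℕ) :
    NEc A i j (k+1) ↔ SEc (Phi D N A) i j (k+1) := by
  rw [NEc_iff, SEc_iff, F_Phi' g A hc ho, lt_sg]
  rfl

end GR

namespace GR

theorem sort_chain (Q : ℕ × ℕ → ℕ × ℕ → Prop) (hQ : ∀ a b, Q a b → a.1 < b.1) (k : ℕ) :
    ∀ T : Finset (ℕ × ℕ), T.card = k → (∀ a ∈ T, ∀ b ∈ T, a ≠ b → Q a b ∨ Q b a) →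
    ∃ p : ℕ → ℕ × ℕ, (∀ t < k, p t ∈ T) ∧ ∀ t, t + 1 < k → Q (p t) (p (t+1)) := by
  induction k with
  | zero => intro T _ _; exact ⟨fun _ => (0,0), by simp, by simp⟩
  | succ k ih =>
    intro T hT h
    have hne : T.Nonempty := by rw [← Finset.card_pos]; omega
    obtain ⟨a, ha, hm⟩ := Finset.exists_max_image T (fun x => x.1) hne
    obtain ⟨p, hp, hq⟩ := ih (T.erase a) (by rw [Finset.card_erase_of_mem ha]; omega)
      (fun x hx y hy => h x (Finset.mem_of_mem_erase hx) y (Finset.mem_of_mem_erase hy))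
    refine ⟨fun t => if t < k then p t else a, ?_, ?_⟩
    · intro t ht
      by_cases h1 : t < k
      · simp only [h1, if_true]; exact Finset.mem_of_mem_erase (hp t h1)
      · simp only [h1, if_false]; exact ha
    · intro t ht
      have h1 : t < k := by omega
      by_cases h2 : t + 1 < k
      · simp only [h1, h2, if_true]; exact hq t h2
      · simp only [h1, h2, if_true, if_false]
        have h3 := hp t h1
        rcases h (p t) (Finset.mem_of_mem_erase h3) a ha (Finset.ne_of_mem_erase h3) with h4 | h4
        · exact h4
        · have := hQ _ _ h4
          have := hm (p t) (Finset.mem_of_mem_erase h3)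
          omega

theorem seq_mono (f : ℕ → ℕ) (k : ℕ) (h : ∀ t, t + 1 < k → f t < f (t+1)) :
    ∀ t s, s < t → t < k → f s < f t := by
  intro t
  induction t with
  | zero => intro s hs; omega
  | succ t ih =>
    intro s hs ht
    have h1 := h t ht
    rcases Nat.lt_or_ge s t with h2 | h2
    · have := ih s h2 (by omega); omega
    · have : s = t := by omega
      subst this; exact h1

theorem seq_anti (f : ℕ → ℕ) (k : ℕ) (h : ∀ t, t + 1 < k → f (t+1) < f t) :
    ∀ t s, s < t → t < k → f t < f s := by
  intro t
  induction t with
  | zero => intro s hs; omega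
  | succ t ih =>
    intro s hs ht
    have h1 := h t ht
    rcases Nat.lt_or_ge s t with h2 | h2
    · have := ih s h2 (by omega); omega
    · have : s = t := by omega
      subst this; exact h1

theorem mem_cells (n : ℕ) (p : ℕ × ℕ) :
    p ∈ cellsP n ↔ 1 ≤ p.1 ∧ p.1 ≤ n ∧ p.2 ≤ 2 * n - 1 ∧ p.1 ≤ p.2 := by
  simp only [cellsP, Finset.mem_filter, Finset.mem_product, Finset.mem_Icc]
  omega

theorem ne_iff (n : ℕ) (S : Finset (ℕ × ℕ)) (hS : S ⊆ cellsP n) (A : ℕ → ℕ → ℕ)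
    (hA : ∀ i j, A i j ≠ 0 ↔ (i < n ∧ i + j + 1 < 2 * n ∧ (i+1, 2*n-1-j) ∈ S)) (k : ℕ)
    (hk : 0 < k) :
    k ≤ neLen S ↔ ∃ I, 1 ≤ I ∧ I ≤ n ∧ NEc A I (2*n-I) k := by
  unfold neLen
  rw [Finset.le_sup_iff (by simpa using hk)]
  constructor
  · rintro ⟨T, hT, hkT⟩
    rw [Finset.mem_filter, Finset.mem_powerset] at hT
    obtain ⟨p, hp, hq⟩ := sort_chain (fun a b => a.1 < b.1 ∧ b.2 < a.2) (fun a b h => h.1) _ T rfl hT.2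
    have hc : ∀ t < T.card, p t ∈ S ∧ 1 ≤ (p t).1 ∧ (p t).1 ≤ n ∧ (p t).2 ≤ 2 * n - 1 ∧
        (p t).1 ≤ (p t).2 := fun t ht =>
      ⟨hT.1 (hp t ht), (mem_cells n _).1 (hS (hT.1 (hp t ht)))⟩
    have h1 := seq_mono (fun t => (p t).1) _ (fun t ht => (hq t ht).1)
    have h2 := seq_anti (fun t => (p t).2) _ (fun t ht => (hq t ht).2)
    have hl := hc (k-1) (by omega)
    refine ⟨(p (k-1)).1, hl.2.1, hl.2.2.1, fun t => (p t).1 - 1, fun t => 2*n-1-(p t).2, ?_, ?_⟩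
    · intro t ht
      have ht' := hc t (by omega)
      have hle : (p t).1 ≤ (p (k-1)).1 ∧ (p (k-1)).2 ≤ (p t).2 := by
        rcases Nat.lt_or_ge t (k-1) with h3 | h3
        · exact ⟨(h1 _ _ h3 (by omega)).le, (h2 _ _ h3 (by omega)).le⟩
        · have : t = k - 1 := by omega
          subst this; exact ⟨le_rfl, le_rfl⟩
      beta_reduce
      refine ⟨by omega, by omega, ?_⟩
      rw [hA]
      refine ⟨by omega, by omega, ?_⟩
      have : ((p t).1 - 1 + 1, 2*n-1-(2*n-1-(p t).2)) = p t := by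
        apply Prod.ext <;> simp only <;> omega
      rw [this]; exact ht'.1
    · intro t ht
      have := hq t (by omega)
      have := hc t (by omega)
      have := hc (t+1) (by omega)
      simp only
      omega
  · rintro ⟨I, hI1, hIn, c, r, h1, h2⟩
    have h3 := seq_mono c k (fun t ht => (h2 t ht).1)
    have h4 := seq_mono r k (fun t ht => (h2 t ht).2)
    have h5 := fun t ht => (hA _ _).1 (h1 t ht).2.2
    refine ⟨(Finset.range k).image (fun t => (c t + 1, 2*n-1-r t)), ?_, ?_⟩
    · rw [Finset.mem_filter, Finset.mem_powerset]
      constructor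
      · intro x hx
        rw [Finset.mem_image] at hx
        obtain ⟨t, ht, rfl⟩ := hx
        exact (h5 t (Finset.mem_range.1 ht)).2.2
      · intro a ha b hb hab
        rw [Finset.mem_image] at ha hb
        obtain ⟨s, hs, rfl⟩ := ha
        obtain ⟨t, ht, rfl⟩ := hb
        rw [Finset.mem_range] at hs ht
        have a1 := h5 s hs
        have a2 := h5 t ht
        simp only
        rcases lt_trichotomy s t with h6 | h6 | h6
        · left
          have := h3 _ _ h6 ht
          have := h4 _ _ h6 ht
          omega
        · subst h6; exact absurd rfl hab
        · right
          have := h3 _ _ h6 hs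
          have := h4 _ _ h6 hs
          omega
    · rw [Finset.card_image_of_injOn, Finset.card_range]
      intro s hs t ht h
      simp only [Finset.coe_range, Set.mem_Iio] at hs ht
      simp only [Prod.mk.injEq] at h
      rcases lt_trichotomy s t with h6 | h6 | h6
      · have := h3 _ _ h6 ht; omega
      · exact h6
      · have := h3 _ _ h6 hs; omega

theorem se_iff (n : ℕ) (S : Finset (ℕ × ℕ)) (hS : S ⊆ cellsP n) (A : ℕ → ℕ → ℕ)
    (hA : ∀ i j, A i j ≠ 0 ↔ (i < n ∧ i + j + 1 < 2 * n ∧ (i+1, 2*n-1-j) ∈ S)) (k : ℕ)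
    (hk : 0 < k) :
    k ≤ seLen S ↔ ∃ I, 1 ≤ I ∧ I ≤ n ∧ SEc A I (2*n-I) k := by
  unfold seLen
  rw [Finset.le_sup_iff (by simpa using hk)]
  constructor
  · rintro ⟨T, hT, hkT⟩
    rw [Finset.mem_filter, Finset.mem_powerset] at hT
    obtain ⟨p, hp, hq⟩ := sort_chain (fun a b => a.1 < b.1 ∧ a.2 < b.2) (fun a b h => h.1) _ T rfl hT.2.1
    have hc : ∀ t < T.card, p t ∈ S ∧ 1 ≤ (p t).1 ∧ (p t).1 ≤ n ∧ (p t).2 ≤ 2 * n - 1 ∧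
        (p t).1 ≤ (p t).2 := fun t ht =>
      ⟨hT.1 (hp t ht), (mem_cells n _).1 (hS (hT.1 (hp t ht)))⟩
    have h1 := seq_mono (fun t => (p t).1) _ (fun t ht => (hq t ht).1)
    have hl := hc (k-1) (by omega)
    refine ⟨(p (k-1)).1, hl.2.1, hl.2.2.1, fun t => (p t).1 - 1, fun t => 2*n-1-(p t).2, ?_, ?_⟩
    · intro t ht
      have ht' := hc t (by omega)
      have hle : (p t).1 ≤ (p (k-1)).1 := by
        rcases Nat.lt_or_ge t (k-1) with h3 | h3
        · exact (h1 _ _ h3 (by omega)).le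
        · have : t = k - 1 := by omega
          subst this; exact le_rfl
      have hle2 := hT.2.2 (p (k-1)) (hp _ (by omega)) (p t) (hp _ (by omega))
      beta_reduce
      refine ⟨by omega, by omega, ?_⟩
      rw [hA]
      refine ⟨by omega, by omega, ?_⟩
      have : ((p t).1 - 1 + 1, 2*n-1-(2*n-1-(p t).2)) = p t := by
        apply Prod.ext <;> simp only <;> omega
      rw [this]; exact ht'.1
    · intro t ht
      have := hq t (by omega)
      have := hc t (by omega)
      have := hc (t+1) (by omega)
      simp only
      omega
  · rintro ⟨I, hI1, hIn, c, r, h1, h2⟩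
    have h3 := seq_mono c k (fun t ht => (h2 t ht).1)
    have h4 := seq_anti r k (fun t ht => (h2 t ht).2)
    have h5 := fun t ht => (hA _ _).1 (h1 t ht).2.2
    refine ⟨(Finset.range k).image (fun t => (c t + 1, 2*n-1-r t)), ?_, ?_⟩
    · rw [Finset.mem_filter, Finset.mem_powerset]
      refine ⟨?_, ?_, ?_⟩
      · intro x hx
        rw [Finset.mem_image] at hx
        obtain ⟨t, ht, rfl⟩ := hx
        exact (h5 t (Finset.mem_range.1 ht)).2.2
      · intro a ha b hb hab
        rw [Finset.mem_image] at ha hb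
        obtain ⟨s, hs, rfl⟩ := ha
        obtain ⟨t, ht, rfl⟩ := hb
        rw [Finset.mem_range] at hs ht
        have a1 := h5 s hs
        have a2 := h5 t ht
        simp only
        rcases lt_trichotomy s t with h6 | h6 | h6
        · left
          have := h3 _ _ h6 ht
          have := h4 _ _ h6 ht
          omega
        · subst h6; exact absurd rfl hab
        · right
          have := h3 _ _ h6 hs
          have := h4 _ _ h6 hs
          omega
      · intro a ha b hb
        rw [Finset.mem_image] at ha hb
        obtain ⟨s, hs, rfl⟩ := ha
        obtain ⟨t, ht, rfl⟩ := hb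
        rw [Finset.mem_range] at hs ht
        have := h1 s hs
        have := h1 t ht
        simp only
        omega
    · rw [Finset.card_image_of_injOn, Finset.card_range]
      intro s hs t ht h
      simp only [Finset.coe_range, Set.mem_Iio] at hs ht
      simp only [Prod.mk.injEq] at h
      rcases lt_trichotomy s t with h6 | h6 | h6
      · have := h3 _ _ h6 ht; omega
      · exact h6
      · have := h3 _ _ h6 hs; omega

def Dn (n : ℕ) (i j : ℕ) : Prop := i < n ∧ i + j + 1 < 2 * n

theorem Dn_good (n : ℕ) : Good (Dn n) (2*n) where
  di i j h := by unfold Dn at *; omega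
  dj i j h := by unfold Dn at *; omega
  bd i j h := by unfold Dn at *; omega

theorem Cl_a (n I : ℕ) (h1 : 1 ≤ I) (h2 : I ≤ n) : Cl (Dn n) I (2*n-I) := by
  obtain ⟨i, rfl⟩ : ∃ i, I = i+1 := ⟨I-1, by omega⟩
  obtain ⟨j, hj⟩ : ∃ j, 2*n-(i+1) = j+1 := ⟨2*n-(i+1)-1, by omega⟩
  rw [hj]
  show Dn n i j
  unfold Dn; omega

theorem Cl_b (n i : ℕ) (h2 : i < n) : Cl (Dn n) i (2*n-1-i) := by
  cases i with
  | zero => unfold Cl; trivial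
  | succ i =>
    obtain ⟨j, hj⟩ : ∃ j, 2*n-1-(i+1) = j+1 := ⟨2*n-1-(i+1)-1, by omega⟩
    rw [hj]
    show Dn n i j
    unfold Dn; omega

def toA (n : ℕ) (f : ℕ × ℕ → ℕ) (i j : ℕ) : ℕ := if Dn n i j then f (i+1, 2*n-1-j) else 0
def toF (n : ℕ) (A : ℕ → ℕ → ℕ) (p : ℕ × ℕ) : ℕ :=
  if p ∈ cellsP n then A (p.1-1) (2*n-1-p.2) else 0

theorem toA_toF (n : ℕ) (A : ℕ → ℕ → ℕ) (hA : ∀ i j, ¬ Dn n i j → A i j = 0) :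
    toA n (toF n A) = A := by
  funext i j
  unfold toA toF
  by_cases h : Dn n i j
  · rw [if_pos h, if_pos]
    · unfold Dn at h
      simp only
      congr 1; omega
    · rw [mem_cells]; unfold Dn at h; simp only; omega
  · rw [if_neg h, hA _ _ h]

theorem toF_toA (n : ℕ) (f : ℕ × ℕ → ℕ) (hf : ∀ p, p ∉ cellsP n → f p = 0) :
    toF n (toA n f) = f := by
  funext p
  unfold toF
  by_cases h : p ∈ cellsP n
  · rw [if_pos h]
    unfold toA
    rw [if_pos]
    · rw [mem_cells] at h
      congr 1
      apply Prod.ext <;> simp only <;> omega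
    · rw [mem_cells] at h; unfold Dn; omega
  · rw [if_neg h, hf _ h]

theorem toA_zero (n : ℕ) (f : ℕ × ℕ → ℕ) (i j : ℕ) (h : ¬ Dn n i j) : toA n f i j = 0 := by
  unfold toA; rw [if_neg h]

theorem toA_supp (n : ℕ) (f : ℕ × ℕ → ℕ) (i j : ℕ) : toA n f i j ≠ 0 ↔
    (i < n ∧ i + j + 1 < 2 * n ∧ (i+1, 2*n-1-j) ∈ (cellsP n).filter fun p => f p ≠ 0) := by
  unfold toA
  by_cases h : Dn n i j
  · rw [if_pos h, Finset.mem_filter, mem_cells]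
    unfold Dn at h
    constructor
    · intro h1; exact ⟨h.1, h.2, by simp only; omega, h1⟩
    · intro h1; exact h1.2.2.2
  · rw [if_neg h]
    unfold Dn at h
    constructor
    · intro h1; exact absurd rfl h1
    · intro h1; omega

theorem Phi_zero (D : ℕ → ℕ → Prop) (N : ℕ) (A : ℕ → ℕ → ℕ) (i j : ℕ) (h : ¬ D i j) :
    Phi D N A i j = 0 := by
  unfold Phi; rw [if_neg h]

def Psi (n : ℕ) (f : ℕ × ℕ → ℕ) : ℕ × ℕ → ℕ := toF n (Phi (Dn n) (2*n) (toA n f))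

theorem toA_Psi (n : ℕ) (f : ℕ × ℕ → ℕ) : toA n (Psi n f) = Phi (Dn n) (2*n) (toA n f) :=
  toA_toF _ _ (fun i j h => Phi_zero _ _ _ i j h)

theorem Psi_zero (n : ℕ) (f : ℕ × ℕ → ℕ) (p : ℕ × ℕ) (h : p ∉ cellsP n) : Psi n f p = 0 := by
  unfold Psi toF; rw [if_neg h]

theorem Psi_inj (n : ℕ) (f g : ℕ × ℕ → ℕ) (hf : ∀ p, p ∉ cellsP n → f p = 0)
    (hg : ∀ p, p ∉ cellsP n → g p = 0) (h : Psi n f = Psi n g) : f = g := by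
  have h1 : toA n f = toA n g := by
    apply Phi_inj (Dn_good n) _ _ (toA_zero n f) (toA_zero n g)
    rw [← toA_Psi, ← toA_Psi, h]
  rw [← toF_toA n f hf, ← toF_toA n g hg, h1]

theorem len_iff (n : ℕ) (f : ℕ × ℕ → ℕ) (k : ℕ) (hk : 0 < k) :
    k ≤ neLen ((cellsP n).filter fun p => f p ≠ 0) ↔
    k ≤ seLen ((cellsP n).filter fun p => Psi n f p ≠ 0) := by
  rw [ne_iff n _ (Finset.filter_subset _ _) (toA n f) (toA_supp n f) k hk,
    se_iff n _ (Finset.filter_subset _ _) (toA n (Psi n f)) (toA_supp n _) k hk, toA_Psi]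
  obtain ⟨k, rfl⟩ : ∃ k', k = k'+1 := ⟨k-1, by omega⟩
  constructor
  · rintro ⟨I, h1, h2, h3⟩
    exact ⟨I, h1, h2, (Phi_chain (Dn_good n) _ (Cl_a n I h1 h2) (by unfold Dn; omega) k).1 h3⟩
  · rintro ⟨I, h1, h2, h3⟩
    exact ⟨I, h1, h2, (Phi_chain (Dn_good n) _ (Cl_a n I h1 h2) (by unfold Dn; omega) k).2 h3⟩

theorem sum_cells (n : ℕ) (f : ℕ × ℕ → ℕ) : ∑ p ∈ cellsP n, f p =
    ∑ i ∈ Finset.range n, ∑ j ∈ Finset.range (2*n-1-i), toA n f i j := by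
  rw [Finset.sum_sigma']
  symm
  apply Finset.sum_bij (fun (x : (_ : ℕ) × ℕ) _ => ((x.1+1, 2*n-1-x.2) : ℕ × ℕ))
  · intro a ha
    simp only [Finset.mem_sigma, Finset.mem_range] at ha
    rw [mem_cells]; simp only; omega
  · rintro ⟨a1, a2⟩ ha ⟨b1, b2⟩ hb h
    simp only [Finset.mem_sigma, Finset.mem_range, Prod.mk.injEq] at ha hb h
    obtain rfl : a1 = b1 := by omega
    obtain rfl : a2 = b2 := by omega
    rfl
  · intro b hb
    rw [mem_cells] at hb
    refine ⟨⟨b.1-1, 2*n-1-b.2⟩, ?_, ?_⟩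
    · simp only [Finset.mem_sigma, Finset.mem_range]; omega
    · apply Prod.ext <;> simp only <;> omega
  · intro a ha
    simp only [Finset.mem_sigma, Finset.mem_range] at ha
    unfold toA; rw [if_pos]
    unfold Dn; omega

theorem Psi_sum (n : ℕ) (f : ℕ × ℕ → ℕ) : ∑ p ∈ cellsP n, Psi n f p = ∑ p ∈ cellsP n, f p := by
  rw [sum_cells, sum_cells, toA_Psi]
  apply Finset.sum_congr rfl
  intro i hi
  rw [Finset.mem_range] at hi
  have h1 := T_Phi (Dn_good n) (toA n f) (Cl_a n (i+1) (by omega) (by omega)) (by unfold Dn; omega)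
  have h2 := T_Phi (Dn_good n) (toA n f) (Cl_b n i hi) (by unfold Dn; omega)
  have e : 2*n-(i+1) = 2*n-1-i := by omega
  rw [e] at h1
  unfold T at h1 h2
  rw [Finset.sum_range_succ, Finset.sum_range_succ] at h1
  omega

end GR

namespace GR

def wc : ℕ → ℕ → ℕ
  | 0, n => if n = 0 then 1 else 0
  | l+1, n => ∑ p ∈ Finset.HasAntidiagonal.antidiagonal n, wc l p.2

theorem card_piAnti (S : Finset (ℕ × ℕ)) : ∀ m : ℕ, (S.piAntidiag m).card = wc S.card m := by
  induction S using Finset.cons_induction with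
  | empty =>
    intro m
    rw [Finset.piAntidiag_empty]
    by_cases h : m = 0 <;> simp [h, wc]
  | cons a s ha ih =>
    intro m
    rw [Finset.piAntidiag_cons ha, Finset.card_disjiUnion, Finset.card_cons, wc]
    apply Finset.sum_congr rfl
    intro p _
    rw [Finset.card_map, ih]

theorem wc_zero : ∀ l : ℕ, wc l 0 = 1 := by
  intro l
  induction l with
  | zero => simp [wc]
  | succ l ih => simp [wc, ih]

def wp (l m : ℕ) : ℕ := if l ≤ m then wc l (m - l) else 0

theorem card_fib (C S : Finset (ℕ × ℕ)) (hS : S ⊆ C) (m : ℕ) :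
    ((C.piAntidiag m).filter fun f => (C.filter fun p => f p ≠ 0) = S).card = wp S.card m := by
  have key : ∀ f ∈ (C.piAntidiag m).filter (fun f => (C.filter fun p => f p ≠ 0) = S),
      (∑ p ∈ S, f p = m) ∧ (∀ p, f p ≠ 0 ↔ p ∈ S) := by
    intro f hf
    rw [Finset.mem_filter, Finset.mem_piAntidiag] at hf
    obtain ⟨⟨h1, h2⟩, h3⟩ := hf
    have h4 : ∀ p, f p ≠ 0 ↔ p ∈ S := by
      intro p
      rw [← h3, Finset.mem_filter]
      exact ⟨fun h => ⟨h2 p h, h⟩, fun h => h.2⟩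
    refine ⟨?_, h4⟩
    rw [← h1]
    apply Finset.sum_subset hS
    intro x _ hx
    by_contra h
    exact hx ((h4 x).1 h)
  have sumone : ∑ p ∈ S, 1 = S.card := by simp
  unfold wp
  split_ifs with h
  · rw [← card_piAnti]
    refine Finset.card_bij' (fun f _ => fun p => f p - 1)
      (fun g _ => fun p => if p ∈ S then g p + 1 else 0) ?_ ?_ ?_ ?_
    · intro f hf
      obtain ⟨h1, h2⟩ := key f hf
      rw [Finset.mem_piAntidiag]
      constructor
      · have : ∑ p ∈ S, f p = ∑ p ∈ S, (f p - 1) + ∑ p ∈ S, 1 := by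
          rw [← Finset.sum_add_distrib]
          apply Finset.sum_congr rfl
          intro p hp
          have := (h2 p).2 hp
          omega
        rw [h1, sumone] at this
        rw [this]; omega
      · intro p hp
        apply (h2 p).1
        intro h0; rw [h0] at hp; exact hp rfl
    · intro g hg
      rw [Finset.mem_piAntidiag] at hg
      rw [Finset.mem_filter, Finset.mem_piAntidiag]
      refine ⟨⟨?_, ?_⟩, ?_⟩
      · rw [← Finset.sum_subset hS]
        · have : ∑ p ∈ S, (if p ∈ S then g p + 1 else 0) = ∑ p ∈ S, g p + ∑ p ∈ S, 1 := by
            rw [← Finset.sum_add_distrib]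
            apply Finset.sum_congr rfl
            intro p hp
            rw [if_pos hp]
          rw [this, hg.1, sumone]; omega
        · intro x _ hx
          rw [if_neg hx]
      · intro p hp
        apply hS
        by_contra h0
        rw [if_neg h0] at hp; exact hp rfl
      · ext p
        rw [Finset.mem_filter]
        by_cases hp : p ∈ S
        · simp [hp, hS hp]
        · simp [hp]
    · intro f hf
      obtain ⟨h1, h2⟩ := key f hf
      funext p
      simp only
      have := h2 p
      by_cases hp : p ∈ S
      · rw [if_pos hp]
        have := (h2 p).2 hp
        omega
      · rw [if_neg hp]
        by_contra h0
        exact hp ((h2 p).1 (fun h => h0 h.symm))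
    · intro g hg
      rw [Finset.mem_piAntidiag] at hg
      funext p
      simp only
      by_cases hp : p ∈ S
      · rw [if_pos hp]; omega
      · rw [if_neg hp]
        by_contra h0
        exact hp (hg.2 p (fun h => h0 h.symm))
  · rw [Finset.card_eq_zero, Finset.eq_empty_iff_forall_notMem]
    intro f hf
    obtain ⟨h1, h2⟩ := key f hf
    apply h
    rw [← sumone, ← h1]
    apply Finset.sum_le_sum
    intro p hp
    have := (h2 p).2 hp
    omega

/-- counting fillings by supports -/
theorem card_by_supp (C : Finset (ℕ × ℕ)) (P : Finset (ℕ × ℕ) → Prop) (m : ℕ) :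
    ((C.piAntidiag m).filter fun f => P (C.filter fun p => f p ≠ 0)).card =
    ∑ S ∈ C.powerset.filter P, wp S.card m := by
  rw [Finset.card_eq_sum_card_fiberwise (f := fun f : ℕ × ℕ → ℕ => C.filter fun p => f p ≠ 0)
    (t := C.powerset.filter P)]
  · apply Finset.sum_congr rfl
    intro S hS
    rw [Finset.mem_filter, Finset.mem_powerset] at hS
    rw [← card_fib C S hS.1, Finset.filter_filter]
    congr 1
    apply Finset.filter_congr
    intro f _
    constructor
    · exact fun h => h.2
    · intro h; refine ⟨?_, h⟩; rw [h]; exact hS.2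
  · intro f hf
    simp only [Finset.coe_filter, Set.mem_ofPred_eq] at hf
    simp only [Finset.coe_filter, Set.mem_ofPred_eq, Finset.mem_powerset]
    exact ⟨Finset.filter_subset _ _, hf.2⟩

theorem sum_by_card (C : Finset (ℕ × ℕ)) (P : Finset (ℕ × ℕ) → Prop) (m : ℕ) :
    ∑ S ∈ C.powerset.filter P, wp S.card m =
    ∑ l ∈ Finset.range (m+1), (C.powerset.filter fun S => P S ∧ S.card = l).card * wp l m := by
  have h1 : ∑ S ∈ C.powerset.filter P, wp S.card m =
      ∑ S ∈ (C.powerset.filter P).filter (fun S => S.card ∈ Finset.range (m+1)), wp S.card m := by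
    symm
    apply Finset.sum_filter_of_ne
    intro S _ hS
    rw [Finset.mem_range]
    unfold wp at hS
    by_contra h
    rw [if_neg (by omega)] at hS
    exact hS rfl
  rw [h1, ← Finset.sum_fiberwise_of_maps_to (t := Finset.range (m+1)) (g := Finset.card)]
  · apply Finset.sum_congr rfl
    intro l hl
    rw [Finset.sum_congr rfl (g := fun _ => wp l m)]
    · rw [Finset.sum_const, smul_eq_mul]
      congr 2
      ext S
      simp only [Finset.mem_filter]
      constructor
      · rintro ⟨⟨⟨a, b⟩, c⟩, d⟩; exact ⟨a, b, d⟩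
      · rintro ⟨a, b, d⟩; exact ⟨⟨⟨a, b⟩, by rw [d]; exact hl⟩, d⟩
    · intro S hS
      rw [Finset.mem_filter] at hS
      rw [hS.2]
  · intro S hS
    rw [Finset.mem_filter] at hS
    exact hS.2

theorem refine_card (C : Finset (ℕ × ℕ)) (P Q : Finset (ℕ × ℕ) → Prop)
    (h : ∀ m, ((C.piAntidiag m).filter fun f => P (C.filter fun p => f p ≠ 0)).card =
      ((C.piAntidiag m).filter fun f => Q (C.filter fun p => f p ≠ 0)).card) (l : ℕ) :
    (C.powerset.filter fun S => P S ∧ S.card = l).card =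
    (C.powerset.filter fun S => Q S ∧ S.card = l).card := by
  induction l using Nat.strong_induction_on with
  | _ l ih =>
    have h1 := h l
    rw [card_by_supp, card_by_supp, sum_by_card, sum_by_card, Finset.sum_range_succ,
      Finset.sum_range_succ] at h1
    have h2 : wp l l = 1 := by unfold wp; simp [wc_zero]
    rw [Finset.sum_congr rfl (fun x hx => by rw [ih x (Finset.mem_range.1 hx)]), h2] at h1
    omega

theorem refine_fill (C : Finset (ℕ × ℕ)) (P Q : Finset (ℕ × ℕ) → Prop)
    (h : ∀ m, ((C.piAntidiag m).filter fun f => P (C.filter fun p => f p ≠ 0)).card =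
      ((C.piAntidiag m).filter fun f => Q (C.filter fun p => f p ≠ 0)).card) (l m : ℕ) :
    ((C.piAntidiag m).filter fun f => P (C.filter fun p => f p ≠ 0) ∧
      (C.filter fun p => f p ≠ 0).card = l).card =
    ((C.piAntidiag m).filter fun f => Q (C.filter fun p => f p ≠ 0) ∧
      (C.filter fun p => f p ≠ 0).card = l).card := by
  have gen : ∀ R : Finset (ℕ × ℕ) → Prop,
    ((C.piAntidiag m).filter fun f => R (C.filter fun p => f p ≠ 0) ∧
      (C.filter fun p => f p ≠ 0).card = l).card =
    (C.powerset.filter fun S => R S ∧ S.card = l).card * wp l m := by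
    intro R
    have h1 := card_by_supp C (fun S => R S ∧ S.card = l) m
    have h2 : ∑ S ∈ C.powerset.filter (fun S => R S ∧ S.card = l), wp S.card m =
        (C.powerset.filter (fun S => R S ∧ S.card = l)).card • wp l m := by
      apply Finset.sum_eq_card_nsmul
      intro S hS
      rw [Finset.mem_filter] at hS
      rw [hS.2.2]
    rw [smul_eq_mul] at h2
    rw [← h2]
    convert h1
  rw [gen P, gen Q, refine_card C P Q h]

theorem count_eq (n k m : ℕ) (hk : 0 < k) :
    (((cellsP n).piAntidiag m).filter fun f => neLen ((cellsP n).filter fun p => f p ≠ 0) = k).card =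
    (((cellsP n).piAntidiag m).filter fun f => seLen ((cellsP n).filter fun p => f p ≠ 0) = k).card := by
  have hz : ∀ f ∈ (cellsP n).piAntidiag m, ∀ p, p ∉ cellsP n → f p = 0 := by
    intro f hf p hp
    rw [Finset.mem_piAntidiag] at hf
    by_contra h
    exact hp (hf.2 p h)
  have hinj : Set.InjOn (Psi n) ((cellsP n).piAntidiag m : Set (ℕ × ℕ → ℕ)) := by
    intro f hf g hg h
    exact Psi_inj n f g (hz f hf) (hz g hg) h
  have himg : ((cellsP n).piAntidiag m).image (Psi n) = (cellsP n).piAntidiag m := by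
    apply Finset.eq_of_subset_of_card_le
    · intro g hg
      rw [Finset.mem_image] at hg
      obtain ⟨f, hf, rfl⟩ := hg
      rw [Finset.mem_piAntidiag] at hf ⊢
      refine ⟨by rw [Psi_sum]; exact hf.1, ?_⟩
      intro p hp
      by_contra h
      exact hp (Psi_zero n f p h)
    · rw [Finset.card_image_of_injOn hinj]
  conv_rhs => rw [← himg, Finset.filter_image]
  rw [Finset.card_image_of_injOn]
  · congr 1
    apply Finset.filter_congr
    intro f _
    have h1 := len_iff n f k hk
    have h2 := len_iff n f (k+1) (by omega)
    omega
  · apply hinj.mono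
    intro f hf
    rw [Finset.mem_coe, Finset.mem_filter] at hf
    exact hf.1

end GR

theorem stmt19 (n k m l : ℕ) (hn : 0 < n) (hk : 0 < k) (hm : 0 < m) (hl : 0 < l) :
    Nat.card {f : ℕ × ℕ → ℕ //
      (∀ p : ℕ × ℕ, p ∉ cellsP n → f p = 0) ∧
      ((cellsP n).filter fun p => f p ≠ 0).card = l ∧
      (∑ p ∈ cellsP n, f p) = m ∧
      neLen ((cellsP n).filter fun p => f p ≠ 0) = k} =
    Nat.card {f : ℕ × ℕ → ℕ //
      (∀ p : ℕ × ℕ, p ∉ cellsP n → f p = 0) ∧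
      ((cellsP n).filter fun p => f p ≠ 0).card = l ∧
      (∑ p ∈ cellsP n, f p) = m ∧
      seLen ((cellsP n).filter fun p => f p ≠ 0) = k} := by
  have gen : ∀ R : Finset (ℕ × ℕ) → Prop,
      Nat.card {f : ℕ × ℕ → ℕ //
      (∀ p : ℕ × ℕ, p ∉ cellsP n → f p = 0) ∧
      ((cellsP n).filter fun p => f p ≠ 0).card = l ∧
      (∑ p ∈ cellsP n, f p) = m ∧
      R ((cellsP n).filter fun p => f p ≠ 0)} =
      (((cellsP n).piAntidiag m).filter fun f => R ((cellsP n).filter fun p => f p ≠ 0) ∧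
      ((cellsP n).filter fun p => f p ≠ 0).card = l).card := by
    intro R
    apply Nat.subtype_card
    intro f
    rw [Finset.mem_filter, Finset.mem_piAntidiag]
    constructor
    · rintro ⟨⟨h1, h2⟩, h3, h4⟩
      exact ⟨fun p hp => by by_contra h; exact hp (h2 p h), h4, h1, h3⟩
    · rintro ⟨h2, h4, h1, h3⟩
      exact ⟨⟨h1, fun p hp => by by_contra h; exact hp (h2 p h)⟩, h3, h4⟩
  rw [gen (fun S => neLen S = k), gen (fun S => seLen S = k)]
  have h0 := GR.refine_fill (cellsP n) (fun S => neLen S = k) (fun S => seLen S = k)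
    (fun m => by convert GR.count_eq n k m hk) l m
  convert h0
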